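/- arXiv:1002.4500 — 2 statements merged into one kernel-verified Lean document; each statement's English description precedes it below -/
import Mathlib

section
/- If p and q are odd coprime integers with p, q ≥ 1, then N(p,q;1/2) = pq/8 + (p+q)/4 + q/(6p) + p/(6q) + 1/(24pq) − s(2p,q) − s(2q,p). -/
open scoped Classical

/-- The set Σ(p,q) = {k/p + l/q : 1 ≤ k ≤ p−1, 1 ≤ l ≤ q−1} ⊆ ℝ. -/
noncomputable def sigmaSet (p q : ℕ) : Finset ℝ :=
  ((Finset.Icc 1 (p - 1)) ×ˢ (Finset.Icc 1 (q - 1))).image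
    (fun kl => (kl.1 : ℝ) / p + (kl.2 : ℝ) / q)

/-- Litherland's formula: σ̂(x) = |Σ(p,q) \ (x,x+1)| − |Σ(p,q) ∩ (x,x+1)|. -/
noncomputable def sigHat (p q : ℕ) (x : ℝ) : ℤ :=
  (((sigmaSet p q).filter (fun y => y ∉ Set.Ioo x (x + 1))).card : ℤ)
    - (((sigmaSet p q).filter (fun y => y ∈ Set.Ioo x (x + 1))).card : ℤ)

/-- The sawtooth function ((x)). -/
noncomputable def saw (x : ℝ) : ℝ :=
  if ∃ n : ℤ, x = n then 0 else Int.fract x - 1 / 2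

/-- The Dedekind sum s(a,b). -/
noncomputable def dedekindSum (a b : ℕ) : ℝ :=
  ∑ j ∈ Finset.range b, saw ((j : ℝ) / b) * saw ((a : ℝ) * j / b)

/-- The generalized Dedekind sum s(a,b;x,y). -/
noncomputable def dedekindSumGen (a b : ℕ) (x y : ℝ) : ℝ :=
  ∑ j ∈ Finset.range b, saw (((j : ℝ) + y) / b) * saw ((a : ℝ) * ((j : ℝ) + y) / b + x)

/-- N(p,q;C) = #{(k,l) ∈ ℤ²_{≥0} : k/p + l/q < 1 − C}. -/
noncomputable def Ncount (p q : ℕ) (C : ℝ) : ℕ :=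
  Set.ncard {kl : ℕ × ℕ | (kl.1 : ℝ) / p + (kl.2 : ℝ) / q < 1 - C}

/-- The second Bernoulli polynomial evaluated at the fractional part: Ψ₂(x). -/
noncomputable def psi2 (x : ℝ) : ℝ := Int.fract x ^ 2 - Int.fract x + 1 / 6


lemma aux_perm (q a c : ℕ) (h : Nat.Coprime q a) (g : ℕ → ℝ) :
    ∑ l ∈ Finset.range q, g ((c + a * l) % q) = ∑ j ∈ Finset.range q, g j := by
  have hinj : Set.InjOn (fun l => (c + a * l) % q) (Finset.range q : Set ℕ) := by
    intro x hx y hy hxy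
    simp only [Finset.coe_range, Set.mem_Iio] at hx hy
    have h1 : c + a * x ≡ c + a * y [MOD q] := hxy
    have h2 : a * x ≡ a * y [MOD q] := Nat.ModEq.add_left_cancel' c h1
    have h3 : x ≡ y [MOD q] := Nat.ModEq.cancel_left_of_coprime h h2
    exact Nat.ModEq.eq_of_lt_of_lt h3 hx hy
  have himg : (Finset.range q).image (fun l => (c + a * l) % q) = Finset.range q := by
    apply Finset.eq_of_subset_of_card_le
    · intro x hx
      obtain ⟨l, hl, rfl⟩ := Finset.mem_image.1 hx
      have := Finset.mem_range.1 hl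
      exact Finset.mem_range.2 (Nat.mod_lt _ (by omega))
    · rw [Finset.card_image_of_injOn hinj]
  conv_rhs => rw [← himg]
  rw [Finset.sum_image hinj]

lemma aux_inner (p q k : ℕ) (hp : 1 ≤ p) (hoq : Odd q) (g : ℕ → ℝ) :
    ∑ l ∈ Finset.range q, g ((2 * q * k + 2 * p * l) % (p * q)) =
      ∑ j ∈ Finset.range q, g ((2 * q * k) % p + p * j) := by
  rw [← aux_perm q 2 (2 * q * k / p) hoq.coprime_two_right
    (fun j => g ((2 * q * k) % p + p * j))]
  apply Finset.sum_congr rfl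
  intro l _
  have e : 2 * q * k + 2 * p * l = 2 * q * k + p * (2 * l) := by ring
  rw [Nat.mod_mul, e, Nat.add_mul_mod_self_left, Nat.add_mul_div_left _ _ (by omega)]

lemma aux_s1 (n : ℕ) : ∑ j ∈ Finset.range n, (j : ℝ) = n * (n - 1) / 2 := by
  induction n with
  | zero => simp
  | succ n ih => rw [Finset.sum_range_succ, ih]; push_cast; ring

lemma aux_s2 (n : ℕ) : ∑ j ∈ Finset.range n, (j : ℝ) ^ 2 = n * (n - 1) * (2 * n - 1) / 6 := by
  induction n with
  | zero => simp
  | succ n ih => rw [Finset.sum_range_succ, ih]; push_cast; ring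

lemma aux_saw (n b : ℕ) (hb : 1 ≤ b) :
    saw ((n : ℝ) / b) = if n % b = 0 then 0 else ((n % b : ℕ) : ℝ) / b - 1 / 2 := by
  have hb' : (b : ℝ) ≠ 0 := by positivity
  unfold saw
  have hiff : (∃ m : ℤ, (n : ℝ) / b = m) ↔ n % b = 0 := by
    constructor
    · rintro ⟨m, hm⟩
      rw [div_eq_iff hb'] at hm
      have : (n : ℤ) = m * b := by exact_mod_cast hm
      have h2 : (b : ℤ) ∣ n := ⟨m, by rw [this]; ring⟩
      exact Nat.mod_eq_zero_of_dvd (by exact_mod_cast h2)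
    · intro h
      obtain ⟨m, rfl⟩ := Nat.dvd_of_mod_eq_zero h
      exact ⟨m, by push_cast; field_simp⟩
  simp only [hiff]
  split_ifs with h
  · rfl
  · congr 1
    have := Int.fract_div_natCast_eq_div_natCast_mod (k := ℝ) (m := n) (n := b)
    simpa using this

lemma aux_dede (a b : ℕ) (hb : 1 ≤ b) (h : Nat.Coprime b a) :
    dedekindSum a b =
      (∑ j ∈ Finset.range b, (j : ℝ) * ((a * j % b : ℕ) : ℝ)) / b ^ 2 - (b - 1) / 4 := by
  have hb' : (b : ℝ) ≠ 0 := by positivity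
  have hterm : ∀ j ∈ Finset.range b, saw ((j : ℝ) / b) * saw ((a : ℝ) * j / b) =
      ((j : ℝ) * ((a * j % b : ℕ) : ℝ)) / b ^ 2 - (j : ℝ) / (2 * b)
       - ((a * j % b : ℕ) : ℝ) / (2 * b) + 1 / 4 - (if j = 0 then 1 / 4 else 0) := by
    intro j hj
    have hj := Finset.mem_range.1 hj
    have e : (a : ℝ) * j = ((a * j : ℕ) : ℝ) := by push_cast; ring
    rw [e, aux_saw _ _ hb, aux_saw _ _ hb, Nat.mod_eq_of_lt hj]
    by_cases h0 : j = 0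
    · subst h0; simp
    · have : a * j % b ≠ 0 := by
        intro h1
        have := h.dvd_of_dvd_mul_left (Nat.dvd_of_mod_eq_zero h1)
        exact h0 (Nat.eq_zero_of_dvd_of_lt this hj)
      rw [if_neg h0, if_neg this, if_neg h0]
      field_simp
      ring
  unfold dedekindSum
  rw [Finset.sum_congr rfl hterm]
  have hperm := aux_perm b a 0 h (fun j => (j : ℝ))
  simp only [zero_add] at hperm
  simp only [Finset.sum_sub_distrib, Finset.sum_add_distrib, ← Finset.sum_div]
  rw [hperm, aux_s1]
  have : (∑ x ∈ Finset.range b, if x = 0 then (1 / 4 : ℝ) else 0) = 1 / 4 := by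
    rw [Finset.sum_ite_eq']; simp; omega
  rw [this]
  simp
  field_simp
  ring

lemma aux_mixed (p q : ℕ) (hp : 1 ≤ p) (hop : Odd p) (hoq : Odd q) (hpq : Nat.Coprime p q) :
    ∑ k ∈ Finset.range p, ∑ l ∈ Finset.range q,
      (k : ℝ) * (((2 * q * k + 2 * p * l) % (p * q) : ℕ) : ℝ) =
    q * p ^ 2 * (dedekindSum (2 * q) p + (p - 1) / 4)
      + p * (q * (q - 1) / 2) * (p * (p - 1) / 2) := by
  have hp' : (p : ℝ) ≠ 0 := by positivity
  rw [aux_dede (2 * q) p hp (Nat.Coprime.mul_right hop.coprime_two_right hpq)]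
  have : ∀ k ∈ Finset.range p, ∑ l ∈ Finset.range q,
      (k : ℝ) * (((2 * q * k + 2 * p * l) % (p * q) : ℕ) : ℝ) =
      q * ((k : ℝ) * ((2 * q * k % p : ℕ) : ℝ)) + p * (q * (q - 1) / 2) * k := by
    intro k _
    rw [aux_inner p q k hp hoq (fun n => (k : ℝ) * (n : ℝ))]
    simp only [Nat.cast_add, Nat.cast_mul, mul_add, Finset.sum_add_distrib, ← Finset.mul_sum]
    rw [aux_s1]
    simp
    ring
  rw [Finset.sum_congr rfl this, Finset.sum_add_distrib, ← Finset.mul_sum, ← Finset.mul_sum, aux_s1]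
  field_simp
  ring

lemma aux_R1 (p q : ℕ) (hp : 1 ≤ p) (hop : Odd p) (hoq : Odd q) (hpq : Nat.Coprime p q) :
    ∑ k ∈ Finset.range p, ∑ l ∈ Finset.range q,
      (((2 * q * k + 2 * p * l) % (p * q) : ℕ) : ℝ) = (p * q) * (p * q - 1) / 2 := by
  have hperm := aux_perm p (2 * q) 0 (Nat.Coprime.mul_right hop.coprime_two_right hpq)
    (fun c => ∑ j ∈ Finset.range q, ((c + p * j : ℕ) : ℝ))
  simp only [zero_add] at hperm
  have : ∀ k ∈ Finset.range p, ∑ l ∈ Finset.range q,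
      (((2 * q * k + 2 * p * l) % (p * q) : ℕ) : ℝ) =
      ∑ j ∈ Finset.range q, ((2 * q * k % p + p * j : ℕ) : ℝ) := fun k _ =>
    aux_inner p q k hp hoq (fun n => (n : ℝ))
  rw [Finset.sum_congr rfl this, hperm]
  simp only [Nat.cast_add, Nat.cast_mul, Finset.sum_add_distrib, ← Finset.mul_sum, aux_s1,
    Finset.sum_const, Finset.card_range, nsmul_eq_mul]
  ring

lemma aux_R2 (p q : ℕ) (hp : 1 ≤ p) (hop : Odd p) (hoq : Odd q) (hpq : Nat.Coprime p q) :
    ∑ k ∈ Finset.range p, ∑ l ∈ Finset.range q,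
      (((2 * q * k + 2 * p * l) % (p * q) : ℕ) : ℝ) ^ 2 =
      (p * q) * (p * q - 1) * (2 * (p * q) - 1) / 6 := by
  have hperm := aux_perm p (2 * q) 0 (Nat.Coprime.mul_right hop.coprime_two_right hpq)
    (fun c => ∑ j ∈ Finset.range q, ((c + p * j : ℕ) : ℝ) ^ 2)
  simp only [zero_add] at hperm
  have : ∀ k ∈ Finset.range p, ∑ l ∈ Finset.range q,
      (((2 * q * k + 2 * p * l) % (p * q) : ℕ) : ℝ) ^ 2 =
      ∑ j ∈ Finset.range q, ((2 * q * k % p + p * j : ℕ) : ℝ) ^ 2 := fun k _ =>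
    aux_inner p q k hp hoq (fun n => (n : ℝ) ^ 2)
  rw [Finset.sum_congr rfl this, hperm]
  have e : ∀ c j : ℕ, ((c + p * j : ℕ) : ℝ) ^ 2 =
      (c : ℝ) ^ 2 + (2 * p * c) * (j : ℝ) + (p : ℝ) ^ 2 * (j : ℝ) ^ 2 := by
    intro c j; push_cast; ring
  simp only [e, Finset.sum_add_distrib, ← Finset.mul_sum, ← Finset.sum_mul, aux_s1, aux_s2,
    Finset.sum_const, Finset.card_range, nsmul_eq_mul]
  ring

/-- The second moment identity. -/
lemma aux_sumM (p q : ℕ) (hp : 1 ≤ p) (hq : 1 ≤ q)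
    (hop : Odd p) (hoq : Odd q) (hpq : Nat.Coprime p q) :
    ∑ k ∈ Finset.range p, ∑ l ∈ Finset.range q,
      ((((2 * q * k + 2 * p * l) / (p * q) : ℕ) : ℝ) - 1) *
      ((((2 * q * k + 2 * p * l) / (p * q) : ℕ) : ℝ) - 2) =
    4 * (p * q / 8 + (p + q)/4 + q/(6 * p) + p/(6 * q) + 1/(24 * p * q)
        - dedekindSum (2 * p) q - dedekindSum (2 * q) p) - (p + q) := by
  have hp' : (p : ℝ) ≠ 0 := by positivity
  have hq' : (q : ℝ) ≠ 0 := by positivity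
  have h1 := aux_mixed p q hp hop hoq hpq
  have h2 := aux_mixed q p hq hoq hop hpq.symm
  rw [Finset.sum_comm] at h2
  have h2' : ∑ k ∈ Finset.range p, ∑ l ∈ Finset.range q,
      (l : ℝ) * (((2 * q * k + 2 * p * l) % (p * q) : ℕ) : ℝ) =
    p * q ^ 2 * (dedekindSum (2 * p) q + (q - 1) / 4)
      + q * (p * (p - 1) / 2) * (q * (q - 1) / 2) := by
    rw [← h2]
    refine Finset.sum_congr rfl fun k _ => Finset.sum_congr rfl fun l _ => ?_
    rw [mul_comm q p, add_comm (2 * p * l)]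
  have h3 := aux_R1 p q hp hop hoq hpq
  have h4 := aux_R2 p q hp hop hoq hpq
  have hterm : ∀ k l : ℕ,
      ((((2 * q * k + 2 * p * l) / (p * q) : ℕ) : ℝ) - 1) *
      ((((2 * q * k + 2 * p * l) / (p * q) : ℕ) : ℝ) - 2) =
      (4 / p ^ 2) * (k : ℝ) ^ 2 + (4 / q ^ 2) * (l : ℝ) ^ 2 + (8 / (p * q)) * ((k : ℝ) * (l : ℝ))
      + (1 / (p * q) ^ 2) * (((2 * q * k + 2 * p * l) % (p * q) : ℕ) : ℝ) ^ 2
      - (4 / (p ^ 2 * q)) * ((k : ℝ) * (((2 * q * k + 2 * p * l) % (p * q) : ℕ) : ℝ))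
      - (4 / (p * q ^ 2)) * ((l : ℝ) * (((2 * q * k + 2 * p * l) % (p * q) : ℕ) : ℝ))
      - (6 / p) * (k : ℝ) - (6 / q) * (l : ℝ)
      + (3 / (p * q)) * (((2 * q * k + 2 * p * l) % (p * q) : ℕ) : ℝ) + 2 := by
    intro k l
    have hdm := Nat.div_add_mod (2 * q * k + 2 * p * l) (p * q)
    have hdm' : ((p : ℝ) * q) * (((2 * q * k + 2 * p * l) / (p * q) : ℕ) : ℝ)
      + (((2 * q * k + 2 * p * l) % (p * q) : ℕ) : ℝ) = 2 * q * k + 2 * p * l := by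
      exact_mod_cast hdm
    generalize (((2 * q * k + 2 * p * l) / (p * q) : ℕ) : ℝ) = M at *
    generalize (((2 * q * k + 2 * p * l) % (p * q) : ℕ) : ℝ) = R at *
    have : R = 2 * q * k + 2 * p * l - p * q * M := by linarith
    rw [this]
    field_simp
    ring
  simp only [hterm, Finset.sum_add_distrib, Finset.sum_sub_distrib, ← Finset.mul_sum]
  simp only [← Finset.mul_sum] at h1
  rw [h1, h2', h3, h4]
  simp only [← Finset.mul_sum, ← Finset.sum_mul, aux_s1, aux_s2,
    Finset.sum_const, Finset.card_range, nsmul_eq_mul]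
  field_simp
  ring

lemma aux_N (p q : ℕ) (hp : 1 ≤ p) (hq : 1 ≤ q) :
    Ncount p q (1/2) = ((Finset.range p ×ˢ Finset.range q).filter
      (fun x => 2 * q * x.1 + 2 * p * x.2 < p * q)).card := by
  unfold Ncount
  rw [← Set.ncard_coe_finset]
  congr 1
  ext ⟨k, l⟩
  have hp' : (0 : ℝ) < p := by positivity
  have hq' : (0 : ℝ) < q := by positivity
  have hiff : (k : ℝ) / p + (l : ℝ) / q < 1 - 1 / 2 ↔ 2 * q * k + 2 * p * l < p * q := by
    rw [div_add_div _ _ hp'.ne' hq'.ne', div_lt_iff₀ (by positivity)]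
    rw [← Nat.cast_lt (α := ℝ)]
    push_cast
    constructor <;> intro h <;> linarith
  simp only [Set.mem_setOf_eq, hiff, Finset.coe_filter, Finset.mem_product, Finset.mem_range]
  constructor
  · intro h
    refine ⟨⟨?_, ?_⟩, h⟩
    · by_contra hc
      push Not at hc
      nlinarith
    · by_contra hc
      push Not at hc
      nlinarith
  · exact fun h => h.2

lemma aux_refl (p q : ℕ) (hop : Odd p) (hoq : Odd q) :
    ((Finset.range p ×ˢ Finset.range q).filter
      (fun x => 3 * (p * q) ≤ 2 * q * x.1 + 2 * p * x.2)).card =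
    ((Finset.range p ×ˢ Finset.range q).filter
      (fun x => 2 * q * x.1 + 2 * p * x.2 < p * q ∧ x.1 ≠ 0 ∧ x.2 ≠ 0)).card := by
  have hodd : Odd (p * q) := hop.mul hoq
  have key : ∀ k l k' l' : ℕ, k + k' = p → l + l' = q →
      (2 * q * k + 2 * p * l) + (2 * q * k' + 2 * p * l') = 4 * (p * q) := by
    intro k l k' l' h1 h2
    subst h1; subst h2; ring
  have hev : ∀ k l : ℕ, 2 * q * k + 2 * p * l = 2 * (q * k + p * l) := by intros; ring
  obtain ⟨t, ht⟩ := hodd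
  refine Finset.card_bij' (fun x _ => (p - x.1, q - x.2)) (fun x _ => (p - x.1, q - x.2)) ?_ ?_ ?_ ?_
  · rintro ⟨k, l⟩ h
    simp only [Finset.mem_filter, Finset.mem_product, Finset.mem_range] at h ⊢
    obtain ⟨⟨hk, hl⟩, h⟩ := h
    have hk0 : k ≠ 0 := by rintro rfl; nlinarith
    have hl0 : l ≠ 0 := by rintro rfl; nlinarith
    have := key k l (p - k) (q - l) (by omega) (by omega)
    have e1 := hev k l
    refine ⟨⟨by omega, by omega⟩, by omega, by omega, by omega⟩
  · rintro ⟨k, l⟩ h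
    simp only [Finset.mem_filter, Finset.mem_product, Finset.mem_range] at h ⊢
    obtain ⟨⟨hk, hl⟩, h, hk0, hl0⟩ := h
    have := key k l (p - k) (q - l) (by omega) (by omega)
    refine ⟨⟨by omega, by omega⟩, by omega⟩
  · rintro ⟨k, l⟩ h
    simp only [Finset.mem_filter, Finset.mem_product, Finset.mem_range] at h ⊢
    ext <;> simp <;> omega
  · rintro ⟨k, l⟩ h
    simp only [Finset.mem_filter, Finset.mem_product, Finset.mem_range] at h ⊢
    ext <;> simp <;> omega

lemma aux_bdry (p q a b : ℕ) (hop : p = 2 * a + 1) (hoq : q = 2 * b + 1) :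
    ((Finset.range p ×ˢ Finset.range q).filter
      (fun x => 2 * q * x.1 + 2 * p * x.2 < p * q)).card =
    ((Finset.range p ×ˢ Finset.range q).filter
      (fun x => 2 * q * x.1 + 2 * p * x.2 < p * q ∧ x.1 ≠ 0 ∧ x.2 ≠ 0)).card + (a + b + 1) := by
  have hT : (((Finset.range (b + 1)).image (fun l => ((0 : ℕ), l))) ∪
      ((Finset.range a).image (fun k => (k + 1, (0 : ℕ))))).card = a + b + 1 := by
    rw [Finset.card_union_of_disjoint, Finset.card_image_of_injective, Finset.card_image_of_injective]
    · simp; omega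
    · intro x y h; simpa using h
    · intro x y h; simpa using h
    · rw [Finset.disjoint_left]
      rintro ⟨k, l⟩ h1 h2
      simp at h1 h2
      omega
  rw [← hT, ← Finset.card_union_of_disjoint]
  · congr 1
    ext ⟨k, l⟩
    simp only [Finset.mem_union, Finset.mem_filter, Finset.mem_product, Finset.mem_range,
      Finset.mem_image, Prod.mk.injEq]
    constructor
    · rintro ⟨⟨hk, hl⟩, h⟩
      by_cases hk0 : k = 0
      · right; left
        subst hk0
        refine ⟨l, ?_, rfl, rfl⟩
        by_contra hc
        have : q + 1 ≤ 2 * l := by omega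
        nlinarith
      by_cases hl0 : l = 0
      · right; right
        subst hl0
        refine ⟨k - 1, ?_, by omega, rfl⟩
        by_contra hc
        have : p + 1 ≤ 2 * k := by omega
        nlinarith
      exact Or.inl ⟨⟨hk, hl⟩, h, hk0, hl0⟩
    · rintro (⟨h1, h2, -⟩ | ⟨l', h, rfl, rfl⟩ | ⟨k', h, rfl, rfl⟩)
      · exact ⟨h1, h2⟩
      · refine ⟨⟨by omega, by omega⟩, ?_⟩
        have : 2 * l' + 1 ≤ q := by omega
        nlinarith
      · refine ⟨⟨by omega, by omega⟩, ?_⟩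
        have : 2 * (k' + 1) + 1 ≤ p := by omega
        nlinarith
  · rw [Finset.disjoint_left]
    rintro ⟨k, l⟩ h1 h2
    simp at h1 h2
    omega

lemma aux_count (p q : ℕ) (hp : 1 ≤ p) (hq : 1 ≤ q) :
    ∑ k ∈ Finset.range p, ∑ l ∈ Finset.range q,
      ((((2 * q * k + 2 * p * l) / (p * q) : ℕ) : ℝ) - 1) *
      ((((2 * q * k + 2 * p * l) / (p * q) : ℕ) : ℝ) - 2) =
    2 * (((Finset.range p ×ˢ Finset.range q).filter
      (fun x => 2 * q * x.1 + 2 * p * x.2 < p * q)).card : ℝ) +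
    2 * (((Finset.range p ×ˢ Finset.range q).filter
      (fun x => 3 * (p * q) ≤ 2 * q * x.1 + 2 * p * x.2)).card : ℝ) := by
  have hpq0 : 0 < p * q := Nat.mul_pos hp hq
  rw [Finset.card_filter, Finset.card_filter]
  push_cast
  rw [Finset.mul_sum, Finset.mul_sum, ← Finset.sum_add_distrib, Finset.sum_product]
  refine Finset.sum_congr rfl fun k hk => Finset.sum_congr rfl fun l hl => ?_
  have hk := Finset.mem_range.1 hk
  have hl := Finset.mem_range.1 hl
  have hlt : (2 * q * k + 2 * p * l) / (p * q) < 4 := by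
    rw [Nat.div_lt_iff_lt_mul hpq0]; nlinarith
  have i0 : 2 * q * k + 2 * p * l < p * q ↔ (2 * q * k + 2 * p * l) / (p * q) < 1 := by
    rw [Nat.div_lt_iff_lt_mul hpq0]; simp
  have i3 : 3 * (p * q) ≤ 2 * q * k + 2 * p * l ↔ 3 ≤ (2 * q * k + 2 * p * l) / (p * q) := by
    rw [Nat.le_div_iff_mul_le hpq0]
  simp only [i0, i3]
  generalize (2 * q * k + 2 * p * l) / (p * q) = M at hlt
  interval_cases M <;> norm_num

theorem rosen_half_odd (p q : ℕ) (hp : 1 ≤ p) (hq : 1 ≤ q)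
    (hop : Odd p) (hoq : Odd q) (hpq : Nat.Coprime p q) :
    (Ncount p q (1/2) : ℝ) =
      p * q / 8 + (p + q)/4 + q/(6 * p) + p/(6 * q) + 1/(24 * p * q)
        - dedekindSum (2 * p) q - dedekindSum (2 * q) p := by
  have h1 := aux_sumM p q hp hq hop hoq hpq
  rw [aux_count p q hp hq, aux_refl p q hop hoq] at h1
  obtain ⟨a, ha⟩ := id hop
  obtain ⟨b, hb⟩ := id hoq
  have h2 := aux_bdry p q a b ha hb
  rw [aux_N p q hp hq]
  have h2' := congrArg (Nat.cast (R := ℝ)) h2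
  rw [Nat.cast_add] at h2'
  have h3 : ((a + b + 1 : ℕ) : ℝ) = ((p : ℝ) + q) / 2 := by
    rw [ha, hb]; push_cast; ring
  rw [h3] at h2'
  linarith
end

section
/- Let p, q ≥ 2 be coprime integers and let C ∈ (0,1) be a real number with Cpq ∉ ℤ. Then the Tristram–Levine signature of the torus knot T_{p,q} at z = e^{2πiC} satisfies σ(z) = −2(C − C²)pq + q/(3p) + p/(3q) + (2 − 4C)((Cpq)) + (2/(pq))·(((Cpq))² − 1/12) − 2(s(p,q;Cp,0) + s(q,p;Cq,0) + s(p,q;(1−C)p,0) + s(q,p;(1−C)q,0)). -/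
open scoped Classical

lemma saw_of_not {x : ℝ} (h : ¬ ∃ n : ℤ, x = n) : saw x = Int.fract x - 1 / 2 := by
  simp only [saw]; rw [if_neg h]

lemma saw_add_int (x : ℝ) (n : ℤ) : saw (x + n) = saw x := by
  by_cases h : ∃ m : ℤ, x = m
  · have h' : ∃ m : ℤ, x + n = m := by
      obtain ⟨m, hm⟩ := h
      exact ⟨m + n, by push_cast; rw [hm]⟩
    simp only [saw]; rw [if_pos h, if_pos h']
  · have h' : ¬ ∃ m : ℤ, x + n = m := by
      rintro ⟨m, hm⟩
      exact h ⟨m - n, by push_cast; linarith⟩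
    rw [saw_of_not h, saw_of_not h', Int.fract_add_intCast]

lemma saw_neg (x : ℝ) : saw (-x) = - saw x := by
  by_cases h : ∃ m : ℤ, x = m
  · have h' : ∃ m : ℤ, -x = m := by
      obtain ⟨m, hm⟩ := h
      exact ⟨-m, by push_cast; rw [hm]⟩
    simp only [saw]; rw [if_pos h, if_pos h']; simp
  · have h' : ¬ ∃ m : ℤ, -x = m := by
      rintro ⟨m, hm⟩
      exact h ⟨-m, by push_cast; linarith⟩
    have h0 : Int.fract x ≠ 0 := by
      intro h0
      apply h
      exact ⟨⌊x⌋, by have := Int.floor_add_fract x; linarith⟩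
    rw [saw_of_not h, saw_of_not h', Int.fract_neg h0]; ring

lemma saw_zero : saw 0 = 0 := by
  simp only [saw]; rw [if_pos ⟨0, by simp⟩]

/-- Value of the sawtooth function from an integer lower bound. -/
lemma saw_val {x : ℝ} (n : ℤ) (h0 : (n : ℝ) < x) (h1 : x < n + 1) : saw x = x - n - 1 / 2 := by
  have hfl : ⌊x⌋ = n := by
    rw [Int.floor_eq_iff]; exact ⟨h0.le, h1⟩
  have h : ¬ ∃ m : ℤ, x = m := by
    rintro ⟨m, rfl⟩
    have a : n < m := by exact_mod_cast h0
    have b : m < n + 1 := by exact_mod_cast h1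
    omega
  rw [saw_of_not h, Int.fract, hfl]

/-- Reindexing sums of 1-periodic functions. -/
lemma sum_perm (f : ℝ → ℝ) (hf : ∀ (x : ℝ) (n : ℤ), f (x + n) = f x) (q : ℕ) (hq : 0 < q)
    (a n : ℤ) (ha : IsCoprime a (q : ℤ)) (z : ℝ) :
    ∑ l ∈ Finset.range q, f (((a : ℝ) * l + n) / q + z)
      = ∑ l ∈ Finset.range q, f ((l : ℝ) / q + z) := by
  have hq' : (0 : ℤ) < q := by exact_mod_cast hq
  have hqR : (q : ℝ) ≠ 0 := by positivity
  have hmem : ∀ l ∈ Finset.range q, ((a * l + n) % (q : ℤ)).toNat ∈ Finset.range q := by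
    intro l _
    have h1 := Int.emod_nonneg (a * l + n) hq'.ne'
    have h2 := Int.emod_lt_of_pos (a * l + n) hq'
    rw [Finset.mem_range]; omega
  have hinj : Set.InjOn (fun l : ℕ => ((a * l + n) % (q : ℤ)).toNat) (Finset.range q) := by
    intro l hl m hm h
    simp only [Finset.coe_range, Set.mem_Iio] at hl hm
    simp only at h
    have h1 := Int.emod_nonneg (a * l + n) hq'.ne'
    have h2 := Int.emod_nonneg (a * m + n) hq'.ne'
    have h3 : (a * l + n) % (q : ℤ) = (a * m + n) % (q : ℤ) := by omega
    have h4 : (q : ℤ) ∣ a * (m - l) := by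
      have := Int.ModEq.dvd h3
      have e : a * m + n - (a * l + n) = a * ((m : ℤ) - l) := by ring
      rwa [e] at this
    have h5 : (q : ℤ) ∣ (m : ℤ) - l := ha.symm.dvd_of_dvd_mul_left h4
    have h6 : (m : ℤ) - l = 0 := by
      apply Int.eq_zero_of_abs_lt_dvd h5
      rw [abs_lt]; constructor <;> omega
    omega
  have himg : (Finset.range q).image (fun l : ℕ => ((a * l + n) % (q : ℤ)).toNat)
      = Finset.range q := by
    apply Finset.eq_of_subset_of_card_le
    · intro x hx
      rw [Finset.mem_image] at hx
      obtain ⟨l, hl, rfl⟩ := hx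
      exact hmem l hl
    · rw [Finset.card_image_of_injOn hinj]
  conv_rhs => rw [← himg]
  rw [Finset.sum_image hinj]
  apply Finset.sum_congr rfl
  intro l _
  have h1 := Int.emod_nonneg (a * l + n) hq'.ne'
  have h2 : ((((a * l + n) % (q : ℤ)).toNat : ℕ) : ℝ) = (((a * l + n) % (q : ℤ) : ℤ) : ℝ) := by
    have : ((((a * l + n) % (q : ℤ)).toNat : ℕ) : ℤ) = (a * l + n) % (q : ℤ) :=
      Int.toNat_of_nonneg h1
    exact_mod_cast congrArg (fun t : ℤ => (t : ℝ)) this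
  have h3 : ((a : ℝ) * l + n) = (((a * l + n) % (q : ℤ) : ℤ) : ℝ)
      + q * (((a * l + n) / (q : ℤ) : ℤ) : ℝ) := by
    have := Int.emod_add_mul_ediv (a * l + n) (q : ℤ)
    have := congrArg (fun t : ℤ => (t : ℝ)) this
    push_cast at this
    push_cast
    linarith
  rw [h2, ← hf ((((a * l + n) % (q : ℤ) : ℤ) : ℝ) / q + z) ((a * l + n) / (q : ℤ))]
  congr 1
  rw [h3]
  field_simp
  ring

/-- Fractional form of the shifted sum. -/
lemma sum_shift (f : ℝ → ℝ) (hf : ∀ (x : ℝ) (n : ℤ), f (x + n) = f x) (q : ℕ) (hq : 0 < q)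
    (u : ℝ) : ∑ l ∈ Finset.range q, f (u + (l : ℝ) / q)
      = ∑ l ∈ Finset.range q, f ((l : ℝ) / q + Int.fract (q * u) / q) := by
  have hqR : (q : ℝ) ≠ 0 := by positivity
  rw [← sum_perm f hf q hq 1 ⌊(q : ℝ) * u⌋ isCoprime_one_left]
  apply Finset.sum_congr rfl
  intro l _
  congr 1
  rw [Int.fract]
  field_simp
  push_cast
  ring

lemma saw_shift_val {q : ℕ} (hq : 0 < q) {u : ℝ} (h : ¬ ∃ n : ℤ, q * u = n) {l : ℕ}
    (hl : l ∈ Finset.range q) :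
    saw ((l : ℝ) / q + Int.fract (q * u) / q) = (l + Int.fract (q * u)) / q - 1 / 2 := by
  have hqR : (0 : ℝ) < q := by positivity
  have hl' : (l : ℝ) + 1 ≤ q := by
    rw [Finset.mem_range] at hl; exact_mod_cast hl
  have h0 : Int.fract ((q : ℝ) * u) ≠ 0 := by
    intro h0
    exact h ⟨⌊(q : ℝ) * u⌋, by have := Int.floor_add_fract ((q : ℝ) * u); linarith⟩
  have h1 : 0 < Int.fract ((q : ℝ) * u) := lt_of_le_of_ne (Int.fract_nonneg _) h0.symm
  have h2 := Int.fract_lt_one ((q : ℝ) * u)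
  rw [← add_div, saw_val 0]
  · push_cast; ring
  · push_cast; positivity
  · push_cast; rw [div_lt_iff₀ hqR]; linarith

lemma sum_lin (N : ℕ) (q t : ℝ) (hq : q ≠ 0) :
    ∑ l ∈ Finset.range N, (((l : ℝ) + t) / q - 1 / 2)
      = ((N : ℝ) * (N - 1) / 2 + N * t) / q - N / 2 := by
  induction N with
  | zero => simp
  | succ N ih => rw [Finset.sum_range_succ, ih]; push_cast; field_simp; ring

lemma sum_quad (N : ℕ) (q t : ℝ) (hq : q ≠ 0) :
    ∑ l ∈ Finset.range N, (((l : ℝ) + t) / q - 1 / 2) ^ 2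
      = ((N : ℝ) * (N - 1) * (2 * N - 1) / 6 + N * (N - 1) * t + N * t ^ 2) / q ^ 2
        - ((N : ℝ) * (N - 1) / 2 + N * t) / q + N / 4 := by
  induction N with
  | zero => simp
  | succ N ih => rw [Finset.sum_range_succ, ih]; push_cast; field_simp; ring

lemma sum_saw_shift (q : ℕ) (hq : 0 < q) (u : ℝ) (h : ¬ ∃ n : ℤ, q * u = n) :
    ∑ l ∈ Finset.range q, saw (u + (l : ℝ) / q) = saw (q * u) := by
  have hqR : (q : ℝ) ≠ 0 := by positivity
  rw [sum_shift saw saw_add_int q hq u, Finset.sum_congr rfl (fun l hl => saw_shift_val hq h hl),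
    sum_lin _ _ _ hqR, saw_of_not h]
  field_simp
  ring

lemma sum_saw_sq_shift (q : ℕ) (hq : 0 < q) (u : ℝ) (h : ¬ ∃ n : ℤ, q * u = n) :
    ∑ l ∈ Finset.range q, saw (u + (l : ℝ) / q) ^ 2
      = (saw (q * u) ^ 2 - 1 / 12) / q + q / 12 := by
  have hqR : (q : ℝ) ≠ 0 := by positivity
  rw [sum_shift (fun x => saw x ^ 2) (fun x n => by simp only [saw_add_int]) q hq u,
    Finset.sum_congr rfl
      (fun l hl => congrArg (fun t : ℝ => t ^ 2) (saw_shift_val hq h hl)),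
    sum_quad _ _ _ hqR, saw_of_not h]
  field_simp
  ring

lemma sum_saw_zero (q : ℕ) (hq : 0 < q) : ∑ l ∈ Finset.range q, saw ((l : ℝ) / q) = 0 := by
  have h := sum_perm saw saw_add_int q hq (-1) 0 (isCoprime_one_left.neg_left) 0
  have h2 : ∑ l ∈ Finset.range q, saw ((((-1 : ℤ) : ℝ) * l + (0 : ℤ)) / q + 0)
      = - ∑ l ∈ Finset.range q, saw ((l : ℝ) / q) := by
    rw [← Finset.sum_neg_distrib]
    apply Finset.sum_congr rfl
    intro l _
    rw [← saw_neg]; congr 1; push_cast; ring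
  rw [h2] at h
  simp only [add_zero] at h
  linarith

lemma sum_range_Icc (q : ℕ) (hq : 0 < q) (f : ℕ → ℝ) :
    ∑ l ∈ Finset.range q, f l = f 0 + ∑ l ∈ Finset.Icc 1 (q - 1), f l := by
  have : Finset.range q = insert 0 (Finset.Icc 1 (q - 1)) := by
    ext x; simp only [Finset.mem_range, Finset.mem_insert, Finset.mem_Icc]; omega
  rw [this, Finset.sum_insert (by simp)]

lemma saw_frac {q l : ℕ} (hl : l ∈ Finset.Icc 1 (q - 1)) :
    0 < (l : ℝ) / q ∧ (l : ℝ) / q < 1 ∧ saw ((l : ℝ) / q) = (l : ℝ) / q - 1 / 2 := by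
  rw [Finset.mem_Icc] at hl
  have h1 : (0 : ℝ) < l := by exact_mod_cast (by omega : 0 < l)
  have h2 : (l : ℝ) < q := by exact_mod_cast (by omega : l < q)
  have h3 : (0 : ℝ) < q := by linarith
  have a : 0 < (l : ℝ) / q := by positivity
  have b : (l : ℝ) / q < 1 := by rw [div_lt_one h3]; exact h2
  refine ⟨a, b, ?_⟩
  rw [saw_val 0 (by push_cast; exact a) (by push_cast; linarith)]
  push_cast; ring

lemma sum_saw_sq (q : ℕ) (hq : 0 < q) : ∑ l ∈ Finset.range q, saw ((l : ℝ) / q) ^ 2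
    = ((q : ℝ) - 1) * (2 * q - 1) / (6 * q) - (q - 1) / 2 + q / 4 - 1 / 4 := by
  have hqR : (q : ℝ) ≠ 0 := by positivity
  have h1 := sum_quad q q 0 hqR
  rw [sum_range_Icc q hq] at h1 ⊢
  rw [Finset.sum_congr rfl (fun l hl => by rw [(saw_frac hl).2.2])]
  simp only [add_zero] at h1
  simp only [Nat.cast_zero, zero_div, saw_zero] at h1 ⊢
  have : ((q : ℝ) - 1) * (2 * q - 1) / (6 * q) - (q - 1) / 2 + q / 4
    = ((q : ℝ) * (q - 1) * (2 * q - 1) / 6 + q * (q - 1) * 0 + q * 0 ^ 2) / q ^ 2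
        - ((q : ℝ) * (q - 1) / 2 + q * 0) / q + q / 4 := by
    field_simp; ring
  rw [this, ← h1]; ring

lemma dede_neg (p q : ℕ) (hq : 0 < q) (w : ℝ) :
    dedekindSumGen p q (-w) 0 = dedekindSumGen p q w 0 := by
  have h := sum_perm (fun x => saw x * saw (p * x + w)) (fun x n => by
    have : (p : ℝ) * (x + n) + w = p * x + w + ((p * n : ℤ) : ℝ) := by push_cast; ring
    rw [this, saw_add_int, saw_add_int]) q hq (-1) 0 (isCoprime_one_left.neg_left) 0
  simp only [dedekindSumGen]
  refine Eq.trans ?_ (h.trans ?_)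
  · apply Finset.sum_congr rfl
    intro l _
    have e1 : ((((-1 : ℤ) : ℝ) * l + (0 : ℤ)) / q + 0) = -(((l : ℝ) + 0) / q) := by
      push_cast; ring
    have e2 : (p : ℝ) * -(((l : ℝ) + 0) / q) + w = -((p : ℝ) * ((l : ℝ) + 0) / q + -w) := by ring
    rw [e1, e2, saw_neg, saw_neg]; ring
  · apply Finset.sum_congr rfl
    intro l _
    simp only [add_zero, mul_div_assoc]

lemma dede_one_sub (p q : ℕ) (hq : 0 < q) (C : ℝ) :
    dedekindSumGen p q ((1 - C) * p) 0 = dedekindSumGen p q (C * p) 0 := by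
  rw [← dede_neg p q hq (C * p)]
  simp only [dedekindSumGen]
  apply Finset.sum_congr rfl
  intro l _
  rw [← saw_add_int ((p : ℝ) * ((l : ℝ) + 0) / q + -(C * p)) p]
  congr 2
  push_cast; ring

/-- The sum of a(k) c(k,l) is a generalized Dedekind sum. -/
lemma cross_sum (p q : ℕ) (hp : 0 < p) (hq : 0 < q) (C : ℝ)
    (hCpq : ¬ ∃ n : ℤ, C * p * q = n) :
    ∑ k ∈ Finset.range p, ∑ l ∈ Finset.range q,
      saw ((k : ℝ) / p) * saw ((k : ℝ) / p + (l : ℝ) / q - C)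
      = dedekindSumGen q p (C * q) 0 := by
  have hpR : (p : ℝ) ≠ 0 := by positivity
  rw [← dede_neg q p hp]
  simp only [dedekindSumGen]
  apply Finset.sum_congr rfl
  intro k _
  rw [← Finset.mul_sum]
  have h : ¬ ∃ n : ℤ, (q : ℝ) * ((k : ℝ) / p - C) = n := by
    rintro ⟨n, hn⟩
    apply hCpq
    refine ⟨q * k - n * p, ?_⟩
    push_cast
    rw [← hn]; field_simp; ring
  have := sum_saw_shift q hq ((k : ℝ) / p - C) h
  rw [add_zero]
  congr 1
  rw [show (q : ℝ) * (k : ℝ) / p + -(C * q) = (q : ℝ) * ((k : ℝ) / p - C) by ring, ← this]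
  apply Finset.sum_congr rfl
  intro l _
  congr 1; ring

lemma c_sums (p q : ℕ) (hp : 0 < p) (hq : 0 < q) (hpq : Nat.Coprime p q) (C : ℝ)
    (hCpq : ¬ ∃ n : ℤ, C * p * q = n) :
    (∑ k ∈ Finset.range p, ∑ l ∈ Finset.range q, saw ((k : ℝ) / p + (l : ℝ) / q - C)
      = - saw (C * p * q)) ∧
    (∑ k ∈ Finset.range p, ∑ l ∈ Finset.range q, saw ((k : ℝ) / p + (l : ℝ) / q - C) ^ 2
      = (saw (C * p * q) ^ 2 - 1 / 12) / (p * q) + p * q / 12) := by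
  have hpR : (p : ℝ) ≠ 0 := by positivity
  have hqR : (q : ℝ) ≠ 0 := by positivity
  have h : ∀ k : ℕ, ¬ ∃ n : ℤ, (q : ℝ) * ((k : ℝ) / p - C) = n := by
    rintro k ⟨n, hn⟩
    apply hCpq
    refine ⟨q * k - n * p, ?_⟩
    push_cast
    rw [← hn]; field_simp; ring
  have h' : ¬ ∃ n : ℤ, (p : ℝ) * (-(C * q)) = n := by
    rintro ⟨n, hn⟩
    exact hCpq ⟨-n, by push_cast; rw [← hn]; ring⟩
  have hco : IsCoprime (q : ℤ) (p : ℤ) := Nat.isCoprime_iff_coprime.2 hpq.symm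
  have key : ∀ f : ℝ → ℝ, (∀ (x : ℝ) (n : ℤ), f (x + n) = f x) →
      ∑ k ∈ Finset.range p, f ((q : ℝ) * ((k : ℝ) / p - C))
        = ∑ k ∈ Finset.range p, f (-(C * q) + (k : ℝ) / p) := by
    intro f hf
    have := sum_perm f hf p hp q 0 hco (-(C * q))
    refine Eq.trans ?_ (this.trans ?_)
    · apply Finset.sum_congr rfl
      intro k _
      congr 1; push_cast; ring
    · apply Finset.sum_congr rfl
      intro k _
      congr 1; ring
  have e : saw (p * -(C * q)) = - saw (C * p * q) := by
    rw [← saw_neg]; congr 1; ring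
  have r : ∀ k l : ℕ, (k : ℝ) / p + (l : ℝ) / q - C = ((k : ℝ) / p - C) + (l : ℝ) / q := by
    intros; ring
  simp only [r]
  constructor
  · rw [Finset.sum_congr rfl (fun k _ => sum_saw_shift q hq _ (h k)), key saw saw_add_int,
      sum_saw_shift p hp _ h', e]
  · rw [Finset.sum_congr rfl (fun k _ => sum_saw_sq_shift q hq _ (h k)), Finset.sum_add_distrib,
      ← Finset.sum_div, Finset.sum_sub_distrib,
      key (fun x => saw x ^ 2) (fun x n => by simp only [saw_add_int]),
      sum_saw_sq_shift p hp _ h', e]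
    simp only [Finset.sum_const, Finset.card_range, nsmul_eq_mul]
    field_simp
    ring

/-- The key double sum. -/
noncomputable def tterm (p q : ℕ) (C : ℝ) (k l : ℕ) : ℝ :=
  saw ((k : ℝ) / p) + saw ((l : ℝ) / q) - saw ((k : ℝ) / p + (l : ℝ) / q - C) + (1 / 2 - C)

lemma tsum_analytic (p q : ℕ) (hp : 0 < p) (hq : 0 < q) (hpq : Nat.Coprime p q) (C : ℝ)
    (hCpq : ¬ ∃ n : ℤ, C * p * q = n) :
    ∑ k ∈ Finset.range p, ∑ l ∈ Finset.range q, tterm p q C k l ^ 2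
      = q * (((p : ℝ) - 1) * (2 * p - 1) / (6 * p) - (p - 1) / 2 + p / 4 - 1 / 4)
        + p * (((q : ℝ) - 1) * (2 * q - 1) / (6 * q) - (q - 1) / 2 + q / 4 - 1 / 4)
        + ((saw (C * p * q) ^ 2 - 1 / 12) / (p * q) + p * q / 12)
        + p * q * (1 / 2 - C) ^ 2
        - 2 * dedekindSumGen q p (C * q) 0 - 2 * dedekindSumGen p q (C * p) 0
        + 2 * (1 / 2 - C) * saw (C * p * q) := by
  obtain ⟨c1, c2⟩ := c_sums p q hp hq hpq C hCpq
  have x1 := cross_sum p q hp hq C hCpq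
  have x2 := cross_sum q p hq hp C (by
    rintro ⟨n, hn⟩; exact hCpq ⟨n, by rw [← hn]; ring⟩)
  rw [Finset.sum_comm] at x2
  have x2' : ∑ k ∈ Finset.range p, ∑ l ∈ Finset.range q,
      saw ((l : ℝ) / q) * saw ((k : ℝ) / p + (l : ℝ) / q - C) = dedekindSumGen p q (C * p) 0 := by
    rw [← x2]
    refine Finset.sum_congr rfl fun k _ => Finset.sum_congr rfl fun l _ => ?_
    rw [add_comm ((k : ℝ) / p)]
  simp only [← Finset.mul_sum] at x1
  have a1 := sum_saw_zero p hp
  have b1 := sum_saw_zero q hq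
  have a2 := sum_saw_sq p hp
  have b2 := sum_saw_sq q hq
  have ex : ∀ k l : ℕ, tterm p q C k l ^ 2 = saw ((k : ℝ) / p) ^ 2 + saw ((l : ℝ) / q) ^ 2
      + saw ((k : ℝ) / p + (l : ℝ) / q - C) ^ 2 + (1 / 2 - C) ^ 2
      + (2 * saw ((k : ℝ) / p)) * saw ((l : ℝ) / q)
      + (2 * (1 / 2 - C)) * saw ((k : ℝ) / p)
      + (2 * (1 / 2 - C)) * saw ((l : ℝ) / q)
      - 2 * (saw ((k : ℝ) / p) * saw ((k : ℝ) / p + (l : ℝ) / q - C))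
      - 2 * (saw ((l : ℝ) / q) * saw ((k : ℝ) / p + (l : ℝ) / q - C))
      - (2 * (1 / 2 - C)) * saw ((k : ℝ) / p + (l : ℝ) / q - C) := by
    intro k l; simp only [tterm]; ring
  simp only [ex, Finset.sum_add_distrib, Finset.sum_sub_distrib, ← Finset.mul_sum, c1, c2, x1, x2',
    b1, a1, b2, a2, mul_zero, Finset.sum_const, Finset.card_range, nsmul_eq_mul]
  ring

lemma tsum_comb (p q : ℕ) (hp : 2 ≤ p) (hq : 2 ≤ q) (C : ℝ) (hC : C ∈ Set.Ioo (0:ℝ) 1)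
    (hCpq : ¬ ∃ n : ℤ, C * p * q = n) :
    ∑ k ∈ Finset.range p, ∑ l ∈ Finset.range q, tterm p q C k l ^ 2
      = ((p : ℝ) - 1 + (q - 1)) / 4 + ∑ k ∈ Finset.Icc 1 (p - 1), ∑ l ∈ Finset.Icc 1 (q - 1),
        (if (k : ℝ) / p + (l : ℝ) / q ∉ Set.Ioo C (C + 1) then (1 : ℝ) else 0) := by
  obtain ⟨hC0, hC1⟩ := hC
  have hpR : (p : ℝ) ≠ 0 := by positivity
  have hqR : (q : ℝ) ≠ 0 := by positivity
  have hne : ∀ (k l : ℕ) (m : ℤ), (k : ℝ) / p + (l : ℝ) / q ≠ C + m := by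
    intro k l m h
    apply hCpq
    refine ⟨k * q + l * p - m * p * q, ?_⟩
    have : C = (k : ℝ) / p + (l : ℝ) / q - m := by linarith
    rw [this]; push_cast; field_simp
  have t00 : tterm p q C 0 0 = 0 := by
    simp only [tterm, Nat.cast_zero, zero_div, saw_zero, zero_add, zero_sub]
    rw [saw_val (-1) (by push_cast; linarith) (by push_cast; linarith)]
    push_cast; ring
  have t0l : ∀ l ∈ Finset.Icc 1 (q - 1), tterm p q C 0 l ^ 2 = 1 / 4 := by
    intro l hl
    obtain ⟨h0, h1, h2⟩ := saw_frac hl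
    have n0 := hne 0 l 0
    simp only [Nat.cast_zero, zero_div, zero_add, Int.cast_zero, add_zero] at n0
    simp only [tterm, Nat.cast_zero, zero_div, saw_zero, zero_add, h2]
    rcases lt_or_gt_of_ne n0 with h | h
    · rw [saw_val (-1) (by push_cast; linarith) (by push_cast; linarith)]
      push_cast; ring
    · rw [saw_val 0 (by push_cast; linarith) (by push_cast; linarith)]
      push_cast; ring
  have tk0 : ∀ l ∈ Finset.Icc 1 (p - 1), tterm p q C l 0 ^ 2 = 1 / 4 := by
    intro l hl
    obtain ⟨h0, h1, h2⟩ := saw_frac hl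
    have n0 := hne l 0 0
    simp only [Nat.cast_zero, zero_div, Int.cast_zero, add_zero] at n0
    simp only [tterm, Nat.cast_zero, zero_div, saw_zero, add_zero, h2]
    rcases lt_or_gt_of_ne n0 with h | h
    · rw [saw_val (-1) (by push_cast; linarith) (by push_cast; linarith)]
      push_cast; ring
    · rw [saw_val 0 (by push_cast; linarith) (by push_cast; linarith)]
      push_cast; ring
  have tkl : ∀ k ∈ Finset.Icc 1 (p - 1), ∀ l ∈ Finset.Icc 1 (q - 1), tterm p q C k l ^ 2
      = if (k : ℝ) / p + (l : ℝ) / q ∉ Set.Ioo C (C + 1) then (1 : ℝ) else 0 := by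
    intro k hk l hl
    obtain ⟨h0, h1, h2⟩ := saw_frac hl
    obtain ⟨g0, g1, g2⟩ := saw_frac hk
    have n0 := hne k l 0
    have n1 := hne k l 1
    simp only [Int.cast_zero, Int.cast_one, add_zero] at n0 n1
    simp only [tterm, h2, g2]
    rcases lt_or_gt_of_ne n0 with h | h
    · rw [if_pos (fun hh => by have := hh.1; linarith),
        saw_val (-1) (by push_cast; linarith) (by push_cast; linarith)]
      push_cast; ring
    · rcases lt_or_gt_of_ne n1 with h' | h'
      · rw [if_neg (not_not.2 ⟨h, h'⟩),
          saw_val 0 (by push_cast; linarith) (by push_cast; linarith)]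
        push_cast; ring
      · rw [if_pos (fun hh => by have := hh.2; linarith),
          saw_val 1 (by push_cast; linarith) (by push_cast; linarith)]
        push_cast; ring
  have hrow : ∀ k ∈ Finset.Icc 1 (p - 1), ∑ l ∈ Finset.range q, tterm p q C k l ^ 2
      = 1 / 4 + ∑ l ∈ Finset.Icc 1 (q - 1),
        (if (k : ℝ) / p + (l : ℝ) / q ∉ Set.Ioo C (C + 1) then (1 : ℝ) else 0) := by
    intro k hk
    rw [sum_range_Icc q (by omega), tk0 k hk, Finset.sum_congr rfl (tkl k hk)]
  rw [sum_range_Icc p (by omega), sum_range_Icc q (by omega), t00, Finset.sum_congr rfl t0l,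
    Finset.sum_congr rfl hrow, Finset.sum_add_distrib]
  simp only [Finset.sum_const, Nat.card_Icc, nsmul_eq_mul]
  have e1 : ((p - 1 + 1 - 1 : ℕ) : ℝ) = (p : ℝ) - 1 := by
    rw [Nat.add_sub_cancel, Nat.cast_sub (by omega)]; simp
  have e2 : ((q - 1 + 1 - 1 : ℕ) : ℝ) = (q : ℝ) - 1 := by
    rw [Nat.add_sub_cancel, Nat.cast_sub (by omega)]; simp
  rw [e1, e2]; ring

lemma sigma_inj (p q : ℕ) (hp : 2 ≤ p) (hq : 2 ≤ q) (hpq : Nat.Coprime p q) :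
    Set.InjOn (fun kl : ℕ × ℕ => (kl.1 : ℝ) / p + (kl.2 : ℝ) / q)
      ((Finset.Icc 1 (p - 1)) ×ˢ (Finset.Icc 1 (q - 1)) : Finset (ℕ × ℕ)) := by
  rintro ⟨k, l⟩ h ⟨k', l'⟩ h' e
  have hpR : (p : ℝ) ≠ 0 := by positivity
  have hqR : (q : ℝ) ≠ 0 := by positivity
  simp only [Finset.coe_product, Set.mem_prod, Finset.coe_Icc, Set.mem_Icc] at h h'
  simp only at e
  have e2 : (k : ℝ) * q + l * p = k' * q + l' * p := by
    field_simp at e; linarith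
  have e3 : (k : ℤ) * q + l * p = k' * q + l' * p := by exact_mod_cast e2
  have hco : IsCoprime (p : ℤ) (q : ℤ) := Nat.isCoprime_iff_coprime.2 hpq
  have hd : (p : ℤ) ∣ (k : ℤ) - k' := by
    apply hco.dvd_of_dvd_mul_right (z := (q : ℤ))
    exact ⟨l' - l, by linarith⟩
  have h6 : (k : ℤ) - k' = 0 := by
    apply Int.eq_zero_of_abs_lt_dvd hd
    rw [abs_lt]; constructor <;> omega
  have hk : k = k' := by omega
  subst hk
  have : (l : ℤ) * p = l' * p := by linarith
  have := mul_right_cancel₀ (by positivity : (p : ℤ) ≠ 0) this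
  have hl : l = l' := by omega
  rw [hl]

lemma sigHat_eq (p q : ℕ) (hp : 2 ≤ p) (hq : 2 ≤ q) (hpq : Nat.Coprime p q) (C : ℝ) :
    (sigHat p q C : ℝ) = 2 * ∑ k ∈ Finset.Icc 1 (p - 1), ∑ l ∈ Finset.Icc 1 (q - 1),
        (if (k : ℝ) / p + (l : ℝ) / q ∉ Set.Ioo C (C + 1) then (1 : ℝ) else 0)
        - (p - 1) * (q - 1) := by
  have hinj := sigma_inj p q hp hq hpq
  have hcard : ((sigmaSet p q).card : ℝ) = (p - 1) * (q - 1) := by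
    rw [sigmaSet, Finset.card_image_of_injOn hinj, Finset.card_product]
    simp only [Nat.card_Icc, Nat.add_sub_cancel]
    rw [Nat.cast_mul, Nat.cast_sub (by omega), Nat.cast_sub (by omega)]
    simp
  have hsplit := Finset.card_filter_add_card_filter_not (s := sigmaSet p q)
    (fun y => y ∈ Set.Ioo C (C + 1))
  have hsplit' : (((sigmaSet p q).filter (fun y => y ∈ Set.Ioo C (C + 1))).card : ℝ)
      + (((sigmaSet p q).filter (fun y => y ∉ Set.Ioo C (C + 1))).card : ℝ)
      = (p - 1) * (q - 1) := by
    rw [← hcard]; exact_mod_cast hsplit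
  have hout : (((sigmaSet p q).filter (fun y => y ∉ Set.Ioo C (C + 1))).card : ℝ)
      = ∑ k ∈ Finset.Icc 1 (p - 1), ∑ l ∈ Finset.Icc 1 (q - 1),
        (if (k : ℝ) / p + (l : ℝ) / q ∉ Set.Ioo C (C + 1) then (1 : ℝ) else 0) := by
    rw [Finset.card_filter, sigmaSet, Finset.sum_image hinj, Finset.sum_product]
    push_cast
    rfl
  rw [← hout]
  simp only [sigHat]
  push_cast
  linarith

theorem tristram_levine_signature_formula (p q : ℕ) (hp : 2 ≤ p) (hq : 2 ≤ q)
    (hpq : Nat.Coprime p q) (C : ℝ) (hC : C ∈ Set.Ioo (0:ℝ) 1)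
    (hCpq : ¬ ∃ n : ℤ, C * p * q = n) :
    (sigHat p q C : ℝ) =
      -2 * (C - C^2) * p * q + q/(3 * p) + p/(3 * q)
        + (2 - 4 * C) * saw (C * p * q)
        + (2/(p * q)) * (saw (C * p * q)^2 - 1/12)
        - 2 * (dedekindSumGen p q (C * p) 0 + dedekindSumGen q p (C * q) 0
            + dedekindSumGen p q ((1 - C) * p) 0 + dedekindSumGen q p ((1 - C) * q) 0) := by
  have hp0 : 0 < p := by omega
  have hq0 : 0 < q := by omega
  have hpR : (p : ℝ) ≠ 0 := by positivity
  have hqR : (q : ℝ) ≠ 0 := by positivity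
  have h1 := tsum_analytic p q hp0 hq0 hpq C hCpq
  rw [tsum_comb p q hp hq C hC hCpq] at h1
  rw [sigHat_eq p q hp hq hpq C, dede_one_sub p q hq0, dede_one_sub q p hp0,
    eq_sub_of_add_eq' h1]
  field_simp
  ring
end
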